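/- arXiv:2009.12670 — 3 statements merged into one kernel-verified Lean document; each statement's English description precedes it below -/
import Mathlib

section
/- Let E be a category with finite limits and finite colimits in which every pullback functor f* : E/Y ⟶ E/X has a right adjoint (i.e. E is locally cartesian closed). Then E is a coherent category: (a) every morphism of E factors as a regular epimorphism followed by a monomorphism; (b) regular epimorphisms in E are stable under pullback; and (c) for every morphism f : X ⟶ Y, pullback of subobjects along f preserves the least subobject and binary unions, i.e. f*(S ∪ T) = f*(S) ∪ f*(T) for all subobjects S, T of Y, where the union of two subobjects is the image of the induced map from their coproduct. -/
open CategoryTheory CategoryTheory.Limits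

universe v u

/-- `U` is the union of the subobjects `S` and `T` of `Y`, i.e. the image of the induced map
from the coproduct `S ⨿ T` to `Y`: the smallest subobject of `Y` through which
`coprod.desc S.arrow T.arrow` factors. -/
def IsImageUnion {E : Type u} [Category.{v} E] [HasBinaryCoproducts E] {Y : E}
    (S T U : Subobject Y) : Prop :=
  U.Factors (coprod.desc S.arrow T.arrow) ∧
    ∀ V : Subobject Y, V.Factors (coprod.desc S.arrow T.arrow) → U ≤ V

/-- A coequalizer diagram in `C` with vertex `Z` is a coequalizer diagram in `Over Z`. -/
noncomputable def CategoryTheory.RegularEpi.overHomMk {C : Type u} [Category.{v} C] {Y Z : C}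
    {g : Y ⟶ Z} (hg : RegularEpi g) :
    RegularEpi (Over.homMk g : Over.mk g ⟶ Over.mk (𝟙 Z)) where
  W := Over.mk (hg.left ≫ g)
  left := Over.homMk hg.left
  right := Over.homMk hg.right hg.w.symm
  w := by ext; exact hg.w
  isColimit := by
    have hepi := hg.epi
    have h (s : Cofork (Over.homMk hg.left : Over.mk (hg.left ≫ g) ⟶ Over.mk g)
        (Over.homMk hg.right hg.w.symm)) :
        hg.left ≫ s.π.left = hg.right ≫ s.π.left :=
      congrArg CommaMorphism.left s.condition
    have fac (s) : g ≫ hg.isColimit.desc (Cofork.ofπ _ (h s)) = s.π.left :=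
      hg.isColimit.fac (Cofork.ofπ _ (h s)) WalkingParallelPair.one
    refine Cofork.IsColimit.mk _
      (fun s ↦ Over.homMk (hg.isColimit.desc (Cofork.ofπ _ (h s))) ?_) (fun s ↦ ?_)
      (fun s m hm ↦ ?_)
    · refine (cancel_epi g).1 ?_
      rw [reassoc_of% fac s]
      exact (Over.w s.π).trans (Category.comp_id g).symm
    · ext
      exact fac s
    · ext
      refine (cancel_epi g).1 ?_
      exact (congrArg CommaMorphism.left hm).trans (fac s).symm

/-- A functor preserving the coequalizer that presents a regular epimorphism preserves it. -/
noncomputable def CategoryTheory.RegularEpi.map {C : Type*} {D : Type*} [Category* C]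
    [Category* D] {X Y : C} {f : X ⟶ Y} (hf : RegularEpi f) (F : C ⥤ D)
    [PreservesColimit (parallelPair hf.left hf.right) F] : RegularEpi (F.map f) where
  W := F.obj hf.W
  left := F.map hf.left
  right := F.map hf.right
  w := by rw [← F.map_comp, hf.w, F.map_comp]
  isColimit := isColimitCoforkMapOfIsColimit F hf.w hf.isColimit

section

variable {E : Type u} [Category.{v} E]

theorem CategoryTheory.Subobject.le_iff_nonempty_over_hom {Y : E} (S T : Subobject Y) :
    S ≤ T ↔ Nonempty (Over.mk S.arrow ⟶ Over.mk T.arrow) :=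
  ⟨fun h ↦ ⟨Over.homMk (ofLE S T h)⟩, fun ⟨k⟩ ↦ le_of_comm k.left (Over.w k)⟩

theorem CategoryTheory.Subobject.factors_coprod_desc_iff [HasBinaryCoproducts E] {Y : E}
    (S T V : Subobject Y) : V.Factors (coprod.desc S.arrow T.arrow) ↔ S ≤ V ∧ T ≤ V := by
  refine ⟨fun h ↦ ⟨?_, ?_⟩, fun ⟨hS, hT⟩ ↦ ?_⟩
  · exact le_of_comm (coprod.inl ≫ V.factorThru _ h)
      (by rw [Category.assoc, factorThru_arrow]; exact coprod.inl_desc _ _)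
  · exact le_of_comm (coprod.inr ≫ V.factorThru _ h)
      (by rw [Category.assoc, factorThru_arrow]; exact coprod.inr_desc _ _)
  · have h : coprod.desc (ofLE S V hS) (ofLE T V hT) ≫ V.arrow = coprod.desc S.arrow T.arrow :=
      (coprod.desc_comp _ _ _).trans (by rw [ofLE_arrow, ofLE_arrow])
    exact h ▸ factors_comp_arrow _

theorem isImageUnion_iff_isLUB [HasBinaryCoproducts E] {Y : E} (S T U : Subobject Y) :
    IsImageUnion S T U ↔ IsLUB {S, T} U := by
  simp only [IsImageUnion, Subobject.factors_coprod_desc_iff, isLUB_iff_le_iff, upperBounds_insert,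
    upperBounds_singleton, Set.mem_inter_iff, Set.mem_Ici]
  exact ⟨fun h V ↦ ⟨fun hU ↦ ⟨h.1.1.trans hU, h.1.2.trans hU⟩, h.2 V⟩,
    fun h ↦ ⟨(h U).1 le_rfl, fun V ↦ (h V).2⟩⟩

variable [HasFiniteLimits E]

/-- Regular epimorphisms are stable under pullback along exponentiable morphisms. -/
theorem isRegularEpi_of_isPullback_of_isLeftAdjoint {P X Y Z : E} {fst : P ⟶ X} {snd : P ⟶ Y}
    {f : X ⟶ Z} {g : Y ⟶ Z} [(Over.pullback f).IsLeftAdjoint] (h : IsPullback fst snd f g)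
    [IsRegularEpi g] : IsRegularEpi fst := by
  let r := ((IsRegularEpi.getStruct g).overHomMk.map (Over.pullback f)).map (Over.forget X)
  refine ⟨⟨r.ofArrowIso (Arrow.isoMk (h.flip.isoPullback.symm)
    (asIso (pullback.snd (𝟙 Z) f)) ?_)⟩⟩
  simpa using (pullback.lift_snd _ _ _).symm

/-- A category with finite limits and coequalizers in which all morphisms are
exponentiable is regular. -/
theorem regular_of_isLeftAdjoint_pullback [HasCoequalizers E]
    (lcc : ∀ {X Y : E} (f : X ⟶ Y), (Over.pullback f).IsLeftAdjoint) : Regular E where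
  hasCoequalizer_of_isKernelPair _ := inferInstance
  regularEpiIsStableUnderBaseChange :=
    .mk' fun _ _ _ f g _ (_ : IsRegularEpi g) ↦
      have := lcc f
      isRegularEpi_of_isPullback_of_isLeftAdjoint (.of_hasPullback f g)

/-- Along an exponentiable morphism, pullback of subobjects has a right adjoint. -/
theorem CategoryTheory.Subobject.exists_gc_pullback {X Y : E} (f : X ⟶ Y)
    [(Over.pullback f).IsLeftAdjoint] :
    ∃ r : Subobject X → Subobject Y, GaloisConnection (Subobject.pullback f).obj r := by
  let R := (Over.pullback f).rightAdjoint
  let adj : Over.pullback f ⊣ R := Adjunction.ofIsLeftAdjoint _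
  have hmono (V : Subobject X) : Mono (R.obj (Over.mk V.arrow)).hom := by
    refine ⟨fun {A} a b hab ↦ ?_⟩
    let a' : Over.mk (a ≫ (R.obj (Over.mk V.arrow)).hom) ⟶ R.obj (Over.mk V.arrow) :=
      Over.homMk a
    let b' : Over.mk (a ≫ (R.obj (Over.mk V.arrow)).hom) ⟶ R.obj (Over.mk V.arrow) :=
      Over.homMk b hab.symm
    have h : a' = b' := (adj.homEquiv _ _).symm.injective <| by
      ext
      exact (cancel_mono V.arrow).1 ((Over.w _).trans (Over.w _).symm)
    exact congrArg CommaMorphism.left h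
  refine ⟨fun V ↦ Subobject.mk (R.obj (Over.mk V.arrow)).hom, fun S V ↦ ?_⟩
  let i : Over.mk ((Subobject.pullback f).obj S).arrow ≅
      (Over.pullback f).obj (Over.mk S.arrow) :=
    Over.isoMk (Subobject.isPullback f S).isoPullback
  let j : Over.mk (Subobject.mk (R.obj (Over.mk V.arrow)).hom).arrow ≅ R.obj (Over.mk V.arrow) :=
    Over.isoMk (Subobject.underlyingIso _)
  rw [le_iff_nonempty_over_hom, le_iff_nonempty_over_hom]
  exact ((i.homCongr (Iso.refl _)).trans ((adj.homEquiv _ _).trans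
    ((Iso.refl _).homCongr j.symm))).nonempty_congr

end

/-- **A locally cartesian closed category with finite limits and finite colimits is coherent:**
(a) every morphism factors as a regular epimorphism followed by a monomorphism;
(b) regular epimorphisms are stable under pullback;
(c) pullback of subobjects preserves the least subobject and binary unions
(where binary unions exist, and the union of two subobjects is the image of the induced map
from their coproduct). -/
theorem statement_1 {E : Type u} [Category.{v} E] [HasFiniteLimits E] [HasFiniteColimits E]
    (lcc : ∀ {X Y : E} (f : X ⟶ Y), (Over.pullback f).IsLeftAdjoint) :
    (∀ {X Y : E} (f : X ⟶ Y), ∃ (Z : E) (e : X ⟶ Z) (m : Z ⟶ Y),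
      Nonempty (RegularEpi e) ∧ Mono m ∧ e ≫ m = f) ∧
    (∀ {P X Y Z : E} (fst : P ⟶ X) (snd : P ⟶ Y) (f : X ⟶ Z) (g : Y ⟶ Z),
      IsPullback fst snd f g → Nonempty (RegularEpi g) → Nonempty (RegularEpi fst)) ∧
    (∀ {X Y : E} (f : X ⟶ Y),
      (∀ U : Subobject Y, (∀ V, U ≤ V) →
        ∀ W : Subobject X, (Subobject.pullback f).obj U ≤ W) ∧
      (∀ S T : Subobject Y, ∃ U : Subobject Y, IsImageUnion S T U) ∧
      (∀ S T U : Subobject Y, IsImageUnion S T U →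
        IsImageUnion ((Subobject.pullback f).obj S) ((Subobject.pullback f).obj T)
          ((Subobject.pullback f).obj U))) := by
  have := regular_of_isLeftAdjoint_pullback lcc
  refine ⟨fun f ↦ ?_, fun fst snd f g h hg ↦ ?_, fun f ↦ ?_⟩
  · let F := Regular.strongEpiMonoFactorisation f
    exact ⟨F.I, F.e, F.m, ⟨IsRegularEpi.getStruct F.e⟩, F.m_mono, F.fac⟩
  · have := lcc f
    have : IsRegularEpi g := ⟨hg⟩
    exact (isRegularEpi_of_isPullback_of_isLeftAdjoint h).regularEpi
  · have := lcc f
    obtain ⟨r, gc⟩ := Subobject.exists_gc_pullback f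
    refine ⟨fun U hU W ↦ (gc U W).2 (hU _), fun S T ↦ ⟨S ⊔ T, ?_⟩, fun S T U h ↦ ?_⟩
    · exact (isImageUnion_iff_isLUB _ _ _).2 isLUB_pair
    · rw [isImageUnion_iff_isLUB] at h ⊢
      simpa [Set.image_pair] using gc.isLUB_l_image h
end

section
/- Let X be a simplicial set, n ≥ 1 and 0 ≤ i ≤ n. Suppose a, b ∈ X_n are degenerate n-simplices: a = X(σ₀)(x₀) and b = X(σ₁)(x₁), where σ₀ : [n] → [k₀] and σ₁ : [n] → [k₁] are surjective morphisms of the simplex category with k₀ < n and k₁ < n. If a and b have the same faces away from i, i.e. X(δⱼ)(a) = X(δⱼ)(b) for every j ≠ i, then a = b. In other words, a horn filling problem against Λ[n,i] has at most one degenerate solution. -/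
open CategoryTheory Simplicial

lemma Fin.val_predAbove_eq_ite {n : ℕ} (p : Fin n) (x : Fin (n + 1)) :
    (p.predAbove x : ℕ) = if (p : ℕ) < x then (x : ℕ) - 1 else x := by
  simp only [Fin.predAbove, Fin.lt_def, Fin.val_castSucc]
  split_ifs <;> simp

lemma Fin.val_succAbove_eq_ite {n : ℕ} (p : Fin (n + 1)) (x : Fin n) :
    (p.succAbove x : ℕ) = if (x : ℕ) < p then (x : ℕ) else x + 1 := by
  simp only [Fin.succAbove, Fin.lt_def, Fin.val_castSucc]
  split_ifs <;> simp

namespace SimplexCategory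

lemma σ_δ_castSucc_σ_collapse {n : ℕ} {p q : Fin (n + 1)} (h : p < q) :
    σ q ≫ δ q.castSucc ≫ σ p ≫ δ p.castSucc ≫ σ q = σ p ≫ δ p.castSucc ≫ σ q := by
  ext x : 3
  apply Fin.ext
  simp only [σ, δ, comp_toOrderHom, OrderHom.comp_coe, Function.comp_apply, Hom.toOrderHom_mk,
    mkHom, Fin.predAboveOrderHom_coe, OrderEmbedding.toOrderHom_coe,
    Fin.succAboveOrderEmb_apply]
  rw [Fin.lt_def] at h
  simp only [Fin.val_predAbove_eq_ite, Fin.val_succAbove_eq_ite, Fin.val_castSucc]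
  grind

lemma σ_δ_succ_σ_collapse {n : ℕ} {p q : Fin (n + 1)} (h : p < q) :
    σ p ≫ δ p.succ ≫ σ q ≫ δ q.succ ≫ σ p = σ q ≫ δ q.succ ≫ σ p := by
  ext x : 3
  apply Fin.ext
  simp only [σ, δ, comp_toOrderHom, OrderHom.comp_coe, Function.comp_apply, Hom.toOrderHom_mk,
    mkHom, Fin.predAboveOrderHom_coe, OrderEmbedding.toOrderHom_coe,
    Fin.succAboveOrderEmb_apply]
  rw [Fin.lt_def] at h
  simp only [Fin.val_predAbove_eq_ite, Fin.val_succAbove_eq_ite, Fin.val_succ]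
  grind

end SimplexCategory

namespace SSet

variable {X : SSet} {n : ℕ}

lemma σ_δ_castSucc_of_mem_range {p : Fin (n + 1)} {a : X _⦋n + 1⦌}
    (ha : a ∈ Set.range (X.σ p)) : X.σ p (X.δ p.castSucc a) = a := by
  obtain ⟨x, rfl⟩ := ha
  simp

lemma σ_δ_succ_of_mem_range {p : Fin (n + 1)} {a : X _⦋n + 1⦌}
    (ha : a ∈ Set.range (X.σ p)) : X.σ p (X.δ p.succ a) = a := by
  obtain ⟨x, rfl⟩ := ha
  simp

lemma eq_of_mem_range_σ {i : Fin (n + 2)} {p : Fin (n + 1)} {a b : X _⦋n + 1⦌}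
    (ha : a ∈ Set.range (X.σ p)) (hb : b ∈ Set.range (X.σ p))
    (h : ∀ j ≠ i, X.δ j a = X.δ j b) : a = b := by
  by_cases hi : p.castSucc = i
  · rw [← σ_δ_succ_of_mem_range ha, ← σ_δ_succ_of_mem_range hb,
      h p.succ (hi ▸ (Fin.castSucc_lt_succ).ne')]
  · rw [← σ_δ_castSucc_of_mem_range ha, ← σ_δ_castSucc_of_mem_range hb, h _ hi]

lemma eq_of_mem_range_σ_of_lt {i : Fin (n + 2)} {p q : Fin (n + 1)} (hpq : p < q)
    {a b : X _⦋n + 1⦌} (ha : a ∈ Set.range (X.σ p)) (hb : b ∈ Set.range (X.σ q))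
    (h : ∀ j ≠ i, X.δ j a = X.δ j b) : a = b := by
  by_cases hi : p.castSucc = i
  · have hq : q.succ ≠ i := hi ▸ (Fin.castSucc_lt_succ.trans (Fin.succ_lt_succ_iff.mpr hpq)).ne'
    refine eq_of_mem_range_σ ha ⟨X.δ p.succ b, ?_⟩ h
    have e := σ_δ_succ_of_mem_range hb
    rw [← h _ hq] at e
    obtain ⟨x, rfl⟩ := ha
    rw [← e]
    simpa [SimplicialObject.σ, SimplicialObject.δ] using
      ConcreteCategory.congr_hom (congrArg (fun f ↦ X.map f.op)
        (SimplexCategory.σ_δ_succ_σ_collapse hpq)) x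
  · refine eq_of_mem_range_σ ⟨X.δ q.castSucc a, ?_⟩ hb h
    have e := σ_δ_castSucc_of_mem_range ha
    rw [h _ hi] at e
    obtain ⟨y, rfl⟩ := hb
    rw [← e]
    simpa [SimplicialObject.σ, SimplicialObject.δ] using
      ConcreteCategory.congr_hom (congrArg (fun f ↦ X.map f.op)
        (SimplexCategory.σ_δ_castSucc_σ_collapse hpq)) y

lemma eq_of_mem_degenerate_of_δ_eq {i : Fin (n + 2)} {a b : X _⦋n + 1⦌}
    (ha : a ∈ X.degenerate (n + 1)) (hb : b ∈ X.degenerate (n + 1))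
    (h : ∀ j ≠ i, X.δ j a = X.δ j b) : a = b := by
  simp only [degenerate_eq_iUnion_range_σ, Set.mem_iUnion] at ha hb
  obtain ⟨p, ha⟩ := ha
  obtain ⟨q, hb⟩ := hb
  rcases lt_trichotomy p q with hpq | rfl | hpq
  · exact eq_of_mem_range_σ_of_lt hpq ha hb h
  · exact eq_of_mem_range_σ ha hb h
  · exact (eq_of_mem_range_σ_of_lt hpq hb ha fun j hj ↦ (h j hj).symm).symm

end SSet

/-- **Degenerate horn fillers are unique.**  Let `X` be a simplicial set and let `a`, `b` be
degenerate `(n+1)`-simplices of `X` (each of the form `X(σ)(x)` for a surjective map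
`σ : [n+1] → [k]` of the simplex category with `k < n+1`).  If `a` and `b` have the same
faces away from `i` (that is, `X(δⱼ)(a) = X(δⱼ)(b)` for all `j ≠ i`), then `a = b`.
In other words, a horn filling problem against `Λ[n+1, i]` has at most one degenerate
solution. -/
theorem statement_4 (X : SSet) (n : ℕ) (i : Fin (n + 2))
    (a b : X.obj (Opposite.op (SimplexCategory.mk (n + 1))))
    (ha : ∃ (k : ℕ) (_ : k < n + 1)
        (σ : SimplexCategory.mk (n + 1) ⟶ SimplexCategory.mk k)
        (x : X.obj (Opposite.op (SimplexCategory.mk k))),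
        Function.Surjective σ.toOrderHom ∧ a = X.map σ.op x)
    (hb : ∃ (k : ℕ) (_ : k < n + 1)
        (σ : SimplexCategory.mk (n + 1) ⟶ SimplexCategory.mk k)
        (x : X.obj (Opposite.op (SimplexCategory.mk k))),
        Function.Surjective σ.toOrderHom ∧ b = X.map σ.op x)
    (hfaces : ∀ j : Fin (n + 2), j ≠ i →
        X.map (SimplexCategory.δ j).op a = X.map (SimplexCategory.δ j).op b) :
    a = b := by
  obtain ⟨k, hk, σ, x, -, rfl⟩ := ha
  obtain ⟨l, hl, τ, y, -, rfl⟩ := hb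
  exact SSet.eq_of_mem_degenerate_of_δ_eq ⟨k, hk, σ, x, rfl⟩ ⟨l, hl, τ, y, rfl⟩ hfaces
end

section
/- Let E be a category with pullbacks and pushouts. Then the evaluation functor ev₀ : Fun(𝐫, E) ⟶ E from the category of retract pairs in E to E, sending a retract pair (i : A ⟶ B, j : B ⟶ A) to A, is both a Grothendieck fibration and a Grothendieck opfibration (a bifibration). -/
open CategoryTheory CategoryTheory.Limits

universe v u

/-- An object of the functor category `Fun(𝐫, E)`, where `𝐫` is the walking retract:
equivalently, a retract pair `(i : A ⟶ B, j : B ⟶ A)` with `j ∘ i = 𝟙 A` in `E`. -/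
structure RetractPair (E : Type u) [Category.{v} E] : Type max u v where
  A : E
  B : E
  i : A ⟶ B
  j : B ⟶ A
  retract : i ≫ j = 𝟙 A

/-- A morphism of retract pairs: a pair of morphisms commuting with both `i` and `j`. -/
@[ext]
structure RetractPairHom {E : Type u} [Category.{v} E] (P Q : RetractPair E) : Type v where
  fA : P.A ⟶ Q.A
  fB : P.B ⟶ Q.B
  comm_i : P.i ≫ fB = fA ≫ Q.i
  comm_j : P.j ≫ fA = fB ≫ Q.j

/-- The category of retract pairs in `E`, i.e. the functor category `Fun(𝐫, E)` for the
walking retract `𝐫`. -/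
instance retractPairCategory (E : Type u) [Category.{v} E] : Category (RetractPair E) where
  Hom := RetractPairHom
  id P := ⟨𝟙 P.A, 𝟙 P.B, by simp, by simp⟩
  comp f g := ⟨f.fA ≫ g.fA, f.fB ≫ g.fB,
    by rw [← Category.assoc, f.comm_i, Category.assoc, g.comm_i, ← Category.assoc],
    by rw [← Category.assoc, f.comm_j, Category.assoc, g.comm_j, ← Category.assoc]⟩
  id_comp f := by apply RetractPairHom.ext <;> simp
  comp_id f := by apply RetractPairHom.ext <;> simp
  assoc f g h := by apply RetractPairHom.ext <;> simp

/-- The evaluation functor `ev₀ : Fun(𝐫, E) ⟶ E` sending a retract pair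
`(i : A ⟶ B, j : B ⟶ A)` to `A`. -/
def ev₀ (E : Type u) [Category.{v} E] : RetractPair E ⥤ E where
  obj P := P.A
  map f := f.fA
  map_id _ := rfl
  map_comp _ _ := rfl

theorem CategoryTheory.Functor.isStronglyCartesian_map {C : Type*} {D : Type*} [Category C]
    [Category D] (p : C ⥤ D) {b a : C} (φ : b ⟶ a)
    (hφ : ∀ (a' : C) (φ' : a' ⟶ a) (g : p.obj a' ⟶ p.obj b), p.map φ' = g ≫ p.map φ →
      ∃! χ : a' ⟶ b, p.map χ = g ∧ χ ≫ φ = φ') :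
    p.IsStronglyCartesian (p.map φ) φ where
  universal_property' {a'} g φ' _ := by
    obtain ⟨χ, ⟨rfl, h⟩, hu⟩ :=
      hφ a' φ' g (IsHomLift.eq_of_isHomLift p (g ≫ p.map φ) φ').symm
    exact ⟨χ, ⟨inferInstance, h⟩, fun ψ ⟨_, h'⟩ =>
      hu ψ ⟨(IsHomLift.eq_of_isHomLift p (p.map χ) ψ).symm, h'⟩⟩

namespace RetractPair

variable {E : Type u} [Category.{v} E]

@[ext]
theorem hom_ext {P Q : RetractPair E} {f g : P ⟶ Q} (hA : f.fA = g.fA) (hB : f.fB = g.fB) :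
    f = g :=
  RetractPairHom.ext hA hB

/-- A morphism of retract pairs whose square of retractions is a pullback has the universal
property of a strongly Cartesian morphism for `ev₀`. -/
theorem existsUnique_comp_of_isPullback {P Q S : RetractPair E} (π : Q ⟶ P)
    (hπ : IsPullback π.fB Q.j P.j π.fA) (φ : S ⟶ P) (g : S.A ⟶ Q.A) (h : φ.fA = g ≫ π.fA) :
    ∃! χ : S ⟶ Q, χ.fA = g ∧ χ ≫ π = φ := by
  have w : φ.fB ≫ P.j = (S.j ≫ g) ≫ π.fA := by rw [← φ.comm_j, h, Category.assoc]
  refine ⟨⟨g, hπ.lift φ.fB (S.j ≫ g) w, hπ.hom_ext ?_ ?_, (hπ.lift_snd _ _ w).symm⟩,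
    ⟨rfl, hom_ext h.symm (hπ.lift_fst _ _ w)⟩, ?_⟩
  · simp [φ.comm_i, π.comm_i, h]
  · simp [reassoc_of% S.retract, Q.retract]
  · rintro χ ⟨rfl, rfl⟩
    exact hom_ext rfl (hπ.hom_ext (hπ.lift_fst _ _ w).symm
      (χ.comm_j.symm.trans (hπ.lift_snd _ _ w).symm))

/-- A morphism of retract pairs whose square of sections is a pushout has the universal
property of a strongly cocartesian morphism for `ev₀`. -/
theorem existsUnique_comp_of_isPushout {P Q S : RetractPair E} (π : P ⟶ Q)
    (hπ : IsPushout P.i π.fA π.fB Q.i) (φ : P ⟶ S) (g : Q.A ⟶ S.A) (h : φ.fA = π.fA ≫ g) :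
    ∃! χ : Q ⟶ S, χ.fA = g ∧ π ≫ χ = φ := by
  have w : P.i ≫ φ.fB = π.fA ≫ g ≫ S.i := by rw [φ.comm_i, h, Category.assoc]
  refine ⟨⟨g, hπ.desc φ.fB (g ≫ S.i) w, hπ.inr_desc _ _ w, hπ.hom_ext ?_ ?_⟩,
    ⟨rfl, hom_ext h.symm (hπ.inl_desc _ _ w)⟩, ?_⟩
  · rw [← Category.assoc, ← π.comm_j, hπ.inl_desc_assoc, ← φ.comm_j, h, Category.assoc]
  · simp [reassoc_of% Q.retract, S.retract]
  · rintro χ ⟨rfl, rfl⟩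
    exact hom_ext rfl (hπ.hom_ext (hπ.inl_desc _ _ w).symm
      (χ.comm_i.trans (hπ.inr_desc _ _ w).symm))

/-- The base change of a retract pair along `f : R ⟶ P.A`, formed by pulling back `P.j`. -/
noncomputable def baseChange [HasPullbacks E] (P : RetractPair E) {R : E} (f : R ⟶ P.A) :
    RetractPair E where
  A := R
  B := pullback P.j f
  i := pullback.lift (f ≫ P.i) (𝟙 R) (by simp [P.retract])
  j := pullback.snd P.j f
  retract := pullback.lift_snd _ _ _

/-- The projection from the base change of a retract pair. -/
noncomputable def baseChangeHom [HasPullbacks E] (P : RetractPair E) {R : E} (f : R ⟶ P.A) :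
    P.baseChange f ⟶ P where
  fA := f
  fB := pullback.fst P.j f
  comm_i := pullback.lift_fst _ _ _
  comm_j := pullback.condition.symm

/-- The cobase change of a retract pair along `f : P.A ⟶ R`, formed by pushing out `P.i`. -/
noncomputable def cobaseChange [HasPushouts E] (P : RetractPair E) {R : E} (f : P.A ⟶ R) :
    RetractPair E where
  A := R
  B := pushout P.i f
  i := pushout.inr P.i f
  j := pushout.desc (P.j ≫ f) (𝟙 R) (by simp [reassoc_of% P.retract])
  retract := pushout.inr_desc _ _ _

/-- The coprojection into the cobase change of a retract pair. -/
noncomputable def cobaseChangeHom [HasPushouts E] (P : RetractPair E) {R : E} (f : P.A ⟶ R) :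
    P ⟶ P.cobaseChange f where
  fA := f
  fB := pushout.inl P.i f
  comm_i := pushout.condition
  comm_j := (pushout.inl_desc _ _ _).symm

end RetractPair

/-- **The evaluation functor from the category of retract pairs is a bifibration:**
if `E` has pullbacks and pushouts, then `ev₀ : Fun(𝐫, E) ⟶ E` is both a Grothendieck
fibration and a Grothendieck opfibration (the latter expressed by saying that the opposite
functor is a Grothendieck fibration). -/
theorem statement_19 (E : Type u) [Category.{v} E] [HasPullbacks E] [HasPushouts E] :
    (ev₀ E).IsFibered ∧ (ev₀ E).op.IsFibered := by
  constructor
  · refine Functor.IsFibered.of_exists_isStronglyCartesian fun P R f =>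
      ⟨P.baseChange f, P.baseChangeHom f, ?_⟩
    exact (ev₀ E).isStronglyCartesian_map (P.baseChangeHom f) fun _ φ g h =>
      RetractPair.existsUnique_comp_of_isPullback _ (IsPullback.of_hasPullback P.j f) φ g h
  · refine Functor.IsFibered.of_exists_isStronglyCartesian fun P R f =>
      ⟨.op (P.unop.cobaseChange f.unop), (P.unop.cobaseChangeHom f.unop).op, ?_⟩
    refine (ev₀ E).op.isStronglyCartesian_map (P.unop.cobaseChangeHom f.unop).op fun _ φ g h => ?_
    obtain ⟨χ, ⟨h₁, h₂⟩, hu⟩ := RetractPair.existsUnique_comp_of_isPushout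
      (P.unop.cobaseChangeHom f.unop) (IsPushout.of_hasPushout P.unop.i f.unop) φ.unop g.unop
      (congrArg Quiver.Hom.unop h)
    exact ⟨χ.op, ⟨congrArg Quiver.Hom.op h₁, congrArg Quiver.Hom.op h₂⟩, fun ψ ⟨h₁', h₂'⟩ =>
      Quiver.Hom.unop_inj (hu ψ.unop ⟨congrArg Quiver.Hom.unop h₁', congrArg Quiver.Hom.unop h₂'⟩)⟩
end
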